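/- arXiv:2209.14580 — 2 statements merged into one kernel-verified Lean document; each statement's English description precedes it below -/
import Mathlib

section
/- If a hermitian d×d matrix-valued free polynomial p(x,y) in the freely noncommuting variables x_1,…,x_μ, y_1,…,y_μ is xy-convex, then there exist a hermitian d×d matrix-valued xy-pencil λ, a positive integer N, and an N×d matrix-valued xy-pencil Λ such that p(x,y) = λ(x,y) + Λ(x,y)* Λ(x,y). -/
open Matrix ComplexOrder

abbrev FreeWord (μ : ℕ) := FreeMonoid (Fin μ ⊕ Fin μ)

abbrev NCPoly (N d μ : ℕ) := FreeWord μ →₀ Matrix (Fin N) (Fin d) ℂ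

noncomputable def wordEval {μ : ℕ} {k : Type*} [Fintype k] [DecidableEq k]
    (X Y : Fin μ → Matrix k k ℂ) (w : FreeWord μ) : Matrix k k ℂ :=
  (w.toList.map (Sum.elim X Y)).prod

noncomputable def polyEval {N d μ : ℕ} {k : Type*} [Fintype k] [DecidableEq k]
    (p : NCPoly N d μ) (X Y : Fin μ → Matrix k k ℂ) :
    Matrix (Fin N × k) (Fin d × k) ℂ :=
  p.sum fun w c => Matrix.kroneckerMap (· * ·) c (wordEval X Y w)

noncomputable def polyStar {N d μ : ℕ} (p : NCPoly N d μ) : NCPoly d N μ :=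
  Finsupp.mapDomain (fun w => FreeMonoid.ofList w.toList.reverse)
    (Finsupp.mapRange Matrix.conjTranspose (by simp) p)

noncomputable def polyMul {a b c μ : ℕ} (p : FreeWord μ →₀ Matrix (Fin a) (Fin b) ℂ)
    (q : FreeWord μ →₀ Matrix (Fin b) (Fin c) ℂ) :
    FreeWord μ →₀ Matrix (Fin a) (Fin c) ℂ :=
  p.sum fun u cu => q.sum fun v cv => Finsupp.single (u * v) (cu * cv)

def loewnerLE {k : Type*} [Fintype k] (A B : Matrix k k ℂ) : Prop := (B - A).PosSemidef

noncomputable def kronId {k l : Type*} (d : ℕ) (V : Matrix k l ℂ) :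
    Matrix (Fin d × k) (Fin d × l) ℂ :=
  Matrix.kroneckerMap (· * ·) (1 : Matrix (Fin d) (Fin d) ℂ) V

noncomputable def compress {μ : ℕ} {k l : Type*} [Fintype k] (V : Matrix k l ℂ)
    (X : Fin μ → Matrix k k ℂ) : Fin μ → Matrix l l ℂ :=
  fun i => Vᴴ * X i * V

def degX {μ : ℕ} (w : FreeWord μ) : ℕ := (w.toList.filter Sum.isLeft).length

def degY {μ : ℕ} (w : FreeWord μ) : ℕ := (w.toList.filter Sum.isRight).length

def IsXYPencil {N d μ : ℕ} (Λ : NCPoly N d μ) : Prop :=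
  ∀ w : FreeWord μ, Λ w ≠ 0 → degX w ≤ 1 ∧ degY w ≤ 1

def IsXYConvex {d μ : ℕ} (p : NCPoly d d μ) : Prop :=
  ∀ (n m : ℕ) (X Y : Fin μ → Matrix (Fin n) (Fin n) ℂ),
    (∀ i, (X i).IsHermitian) → (∀ i, (Y i).IsHermitian) →
    ∀ V : Matrix (Fin n) (Fin m) ℂ, Vᴴ * V = 1 →
    (∀ i j, Vᴴ * (X i * Y j) * V = (Vᴴ * X i * V) * (Vᴴ * Y j * V)) →
    loewnerLE (polyEval p (compress V X) (compress V Y))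
      ((kronId d V)ᴴ * polyEval p X Y * kronId d V)

lemma wordEval_submatrix_equiv {μ : ℕ} {k l : Type*} [Fintype k] [DecidableEq k] [Fintype l]
    [DecidableEq l] (e : l ≃ k) (Z : Fin μ ⊕ Fin μ → Matrix k k ℂ) (w : List (Fin μ ⊕ Fin μ)) :
    (w.map fun x => (Z x).submatrix e e).prod = ((w.map Z).prod).submatrix e e := by
  induction w with
  | nil => simp
  | cons a w ih => simp [ih, Matrix.submatrix_mul_equiv]

lemma sumElim_compress {μ : ℕ} {k l : Type*} [Fintype k] (V : Matrix k l ℂ)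
    (Z : Fin μ ⊕ Fin μ → Matrix k k ℂ) :
    Sum.elim (compress V fun i => Z (.inl i)) (compress V fun i => Z (.inr i)) =
      fun x => Vᴴ * Z x * V := by
  funext x; cases x <;> rfl

/-- The value of the compression defect of `p` along the inclusion `ι`, as a quadratic form. -/
noncomputable def defectForm {d μ : ℕ} (p : NCPoly d d μ) {k l : Type*} [Fintype k]
    [DecidableEq k] [Fintype l] [DecidableEq l] (ι : l → k)
    (Z : Fin μ ⊕ Fin μ → Matrix k k ℂ) (h : Fin d → l → ℂ) : ℂ :=
  p.sum fun w c => ∑ s, ∑ a, ∑ t, ∑ b, star (h s a) * (c s t *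
    (((w.toList.map Z).prod).submatrix ι ι -
      (w.toList.map fun x => (Z x).submatrix ι ι).prod) a b) * h t b

lemma defectForm_nonneg_fin {d μ : ℕ} {p : NCPoly d d μ} (hconv : IsXYConvex p) {n m : ℕ}
    (ι : Fin m → Fin n) (hι : Function.Injective ι)
    (Z : Fin μ ⊕ Fin μ → Matrix (Fin n) (Fin n) ℂ) (hZ : ∀ x, (Z x).IsHermitian)
    (hxy : ∀ i j, (Z (.inl i) * Z (.inr j)).submatrix ι ι =
      (Z (.inl i)).submatrix ι ι * (Z (.inr j)).submatrix ι ι) (h : Fin d → Fin m → ℂ) :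
    0 ≤ defectForm p ι Z h := by
  set V : Matrix (Fin n) (Fin m) ℂ := (1 : Matrix (Fin n) (Fin n) ℂ).submatrix id ι with hVdef
  have hV : ∀ M : Matrix (Fin n) (Fin n) ℂ, Vᴴ * M * V = M.submatrix ι ι := by
    intro M
    ext a b
    simp [hVdef, Matrix.mul_apply, Matrix.one_apply]
  have h1 : Vᴴ * V = 1 := by
    have := hV 1
    rw [Matrix.mul_one] at this
    rw [this, Matrix.submatrix_one ι hι]
  have key := hconv n m (fun i => Z (.inl i)) (fun i => Z (.inr i)) (fun i => hZ _)
    (fun i => hZ _) V h1 (fun i j => by rw [hV, hV, hV, hxy])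
  have key2 := key.dotProduct_mulVec_nonneg (fun q : Fin d × Fin m => h q.1 q.2)
  refine key2.trans_eq ?_
  have hsub : (kronId d V)ᴴ * polyEval p (fun i => Z (.inl i)) (fun i => Z (.inr i)) * kronId d V -
      polyEval p (compress V fun i => Z (.inl i)) (compress V fun i => Z (.inr i)) =
      p.sum fun w c => Matrix.kroneckerMap (· * ·) c
        (((w.toList.map Z).prod).submatrix ι ι -
      (w.toList.map fun x => (Z x).submatrix ι ι).prod) := by
    have e1 : (Sum.elim (fun i => Z (.inl i)) fun i => Z (.inr i)) = Z := by
      funext x; cases x <;> rfl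
    unfold polyEval Finsupp.sum
    rw [Matrix.mul_sum, Matrix.sum_mul, ← Finset.sum_sub_distrib]
    refine Finset.sum_congr rfl fun w _ => ?_
    unfold wordEval
    rw [sumElim_compress, e1]
    simp only [hV]
    ext ⟨s, a⟩ ⟨t, b⟩
    simp [kronId, hVdef, Matrix.mul_apply, Matrix.one_apply, Fintype.sum_prod_type, mul_sub,
      apply_ite (starRingEnd ℂ)]
  rw [hsub]
  unfold defectForm Finsupp.sum
  rw [Matrix.sum_mulVec, dotProduct_sum]
  refine Finset.sum_congr rfl fun w _ => ?_
  simp only [dotProduct, Matrix.mulVec, Finset.mul_sum, Fintype.sum_prod_type, Pi.star_apply,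
    Matrix.kroneckerMap_apply, mul_assoc]

lemma defectForm_nonneg {d μ : ℕ} {p : NCPoly d d μ} (hconv : IsXYConvex p) {k l : Type*}
    [Fintype k] [DecidableEq k] [Fintype l] [DecidableEq l]
    (ι : l → k) (hι : Function.Injective ι)
    (Z : Fin μ ⊕ Fin μ → Matrix k k ℂ) (hZ : ∀ x, (Z x).IsHermitian)
    (hxy : ∀ i j, (Z (.inl i) * Z (.inr j)).submatrix ι ι =
      (Z (.inl i)).submatrix ι ι * (Z (.inr j)).submatrix ι ι) (h : Fin d → l → ℂ) :
    0 ≤ defectForm p ι Z h := by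
  let e := (Fintype.equivFin k).symm
  let f := (Fintype.equivFin l).symm
  have hc : ∀ x, (Z x).submatrix ι ι = (((Z x).submatrix e e).submatrix (e.symm ∘ ι ∘ f)
      (e.symm ∘ ι ∘ f)).submatrix f.symm f.symm := by
    intro x; ext a b; simp
  have := defectForm_nonneg_fin hconv (e.symm ∘ ι ∘ f)
    (e.symm.injective.comp (hι.comp f.injective)) (fun x => (Z x).submatrix e e)
    (fun x => (hZ x).submatrix _) (fun i j => by
      have h2 := congrArg (fun M => M.submatrix f f) (hxy i j)
      simp only [← Matrix.submatrix_mul_equiv _ _ _ f] at h2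
      rw [Matrix.submatrix_mul_equiv]
      convert h2 using 1
      · ext; simp
      · congr 1 <;> (ext; simp)) (fun s a => h s (f a))
  refine this.trans_eq ?_
  unfold defectForm
  congr 1
  funext w c
  refine Finset.sum_congr rfl fun s _ => ?_
  rw [← Equiv.sum_comp f]
  refine Finset.sum_congr rfl fun a _ => ?_
  refine Finset.sum_congr rfl fun t _ => ?_
  rw [← Equiv.sum_comp f]
  refine Finset.sum_congr rfl fun b _ => ?_
  have hc' : (fun x => (Z x).submatrix ι ι) = fun x => (((Z x).submatrix e e).submatrix
      (e.symm ∘ ι ∘ f) (e.symm ∘ ι ∘ f)).submatrix f.symm f.symm := funext hc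
  rw [hc', wordEval_submatrix_equiv f.symm, wordEval_submatrix_equiv e]
  simp

/-- One coefficient of the quadratic form `defectForm`. -/
noncomputable def defectEntry {d μ : ℕ} (p : NCPoly d d μ) {k l : Type*} [Fintype k]
    [DecidableEq k] [Fintype l] [DecidableEq l] (ι : l → k)
    (Z : Fin μ ⊕ Fin μ → Matrix k k ℂ) (s : Fin d) (a : l) (t : Fin d) (b : l) : ℂ :=
  p.sum fun w c => c s t * (((w.toList.map Z).prod).submatrix ι ι -
      (w.toList.map fun x => (Z x).submatrix ι ι).prod) a b

lemma defectForm_eq_sum_defectEntry {d μ : ℕ} (p : NCPoly d d μ) {k l : Type*} [Fintype k]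
    [DecidableEq k] [Fintype l] [DecidableEq l] (ι : l → k)
    (Z : Fin μ ⊕ Fin μ → Matrix k k ℂ) (h : Fin d → l → ℂ) :
    defectForm p ι Z h =
      ∑ s, ∑ a, ∑ t, ∑ b, star (h s a) * defectEntry p ι Z s a t b * h t b := by
  unfold defectForm defectEntry Finsupp.sum
  simp only [Finset.mul_sum, Finset.sum_mul]
  rw [Finset.sum_comm]
  refine Finset.sum_congr rfl fun s _ => ?_
  rw [Finset.sum_comm]
  refine Finset.sum_congr rfl fun a _ => ?_
  rw [Finset.sum_comm]
  refine Finset.sum_congr rfl fun t _ => ?_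
  rw [Finset.sum_comm]

lemma defectForm_pair {d μ : ℕ} (p : NCPoly d d μ) {k l : Type*} [Fintype k]
    [DecidableEq k] [Fintype l] [DecidableEq l] (ι : l → k)
    (Z : Fin μ ⊕ Fin μ → Matrix k k ℂ) (s t : Fin d) (a b : l) (c : ℂ) :
    defectForm p ι Z (fun r i => (if r = s then if i = a then 1 else 0 else 0) +
        if r = t then if i = b then c else 0 else 0) =
      defectEntry p ι Z s a s a + c * defectEntry p ι Z s a t b +
        star c * defectEntry p ι Z t b s a + star c * c * defectEntry p ι Z t b t b := by
  rw [defectForm_eq_sum_defectEntry]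
  simp only [star_add, apply_ite star, star_one, star_zero, add_mul, mul_add,
    Finset.sum_add_distrib, mul_ite, ite_mul, zero_mul, mul_zero, one_mul, mul_one,
    Finset.sum_ite_eq', Finset.sum_ite_irrel, Finset.sum_const_zero, Finset.mem_univ, if_true]
  ring

lemma eq_zero_of_forall_affine_nonneg {D x y : ℂ} (h : ∀ c : ℂ, 0 ≤ D + c * x + star c * y) :
    x = 0 := by
  have re : ∀ r : ℝ, 0 ≤ D.re + r * (x + y).re ∧ (D + r * (x + y)).im = 0 := by
    intro r
    have := Complex.nonneg_iff.1 (h r)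
    simp at this ⊢
    constructor <;> linarith [this.1, this.2]
  have im : ∀ r : ℝ, 0 ≤ D.re + r * (y - x).im ∧ (D + r * (x + y)).im = 0 := by
    intro r
    have := Complex.nonneg_iff.1 (h (r * Complex.I))
    refine ⟨?_, (re r).2⟩
    simp at this ⊢
    linarith [this.1, this.2]
  have aux : ∀ u : ℝ, (∀ r : ℝ, 0 ≤ D.re + r * u) → u = 0 := by
    intro u hu
    by_contra hne
    have := hu (-(D.re + 1) / u)
    rw [div_mul_cancel₀ _ hne] at this
    linarith
  have h1 := aux _ fun r => (re r).1
  have h2 := aux _ fun r => (im r).1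
  have h3 := (re 0).2
  have h4 := (re 1).2
  have h5 := Complex.nonneg_iff.1 (h Complex.I)
  have h6 := Complex.nonneg_iff.1 (h 0)
  simp at h1 h2 h3 h4 h5 h6
  apply Complex.ext <;> simp <;> linarith [h5.2, h6.2]

/-- Weighted adjacency matrices of a path graph whose edges are labelled by the letters of `z`. -/
def pathMatrix {μ : ℕ} (z : List (Fin μ ⊕ Fin μ)) (x : Fin μ ⊕ Fin μ) :
    Matrix (Fin (z.length + 1)) (Fin (z.length + 1)) ℂ :=
  Matrix.of fun i j => if (z[(i : ℕ)]? = some x ∧ (i : ℕ) + 1 = j) ∨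
    (z[(j : ℕ)]? = some x ∧ (j : ℕ) + 1 = i) then 1 else 0

lemma pathMatrix_isHermitian {μ : ℕ} (z : List (Fin μ ⊕ Fin μ)) (x : Fin μ ⊕ Fin μ) :
    (pathMatrix z x).IsHermitian := by
  ext i j
  simp [pathMatrix, Matrix.conjTranspose_apply, apply_ite (starRingEnd ℂ), or_comm]

/-- Remove all entries meeting the index set `P`. -/
def cutMatrix {k : Type*} (P : k → Prop) [DecidablePred P] (M : Matrix k k ℂ) : Matrix k k ℂ :=
  Matrix.of fun i j => if P i ∨ P j then 0 else M i j

lemma prod_map_submatrix_val {μ : ℕ} {k : Type*} [Fintype k] [DecidableEq k] (P : k → Prop)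
    [DecidablePred P] (Z : Fin μ ⊕ Fin μ → Matrix k k ℂ) (w : List (Fin μ ⊕ Fin μ))
    (a b : {i // ¬ P i}) :
    (w.map fun x => (Z x).submatrix (Subtype.val : {i // ¬ P i} → k) Subtype.val).prod a b =
      (w.map fun x => cutMatrix P (Z x)).prod a b := by
  induction w generalizing a with
  | nil => simp [Matrix.one_apply, Subtype.ext_iff]
  | cons x w ih =>
    simp only [List.map_cons, List.prod_cons, Matrix.mul_apply]
    rw [← Fintype.sum_subtype_add_sum_subtype (fun c => ¬ P c), Finset.sum_congr rfl
      (g := fun c : {c // ¬ P c} => cutMatrix P (Z x) a c *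
        (w.map fun x => cutMatrix P (Z x)).prod c b)
      (fun c _ => by rw [ih]; simp [cutMatrix, a.2, c.2])]
    simp only [left_eq_add]
    refine Finset.sum_eq_zero fun c _ => ?_
    have := c.2
    simp only [not_not] at this
    simp [cutMatrix, this]

lemma prod_pathMatrix_apply_last {μ : ℕ} (z w : List (Fin μ ⊕ Fin μ)) (i : Fin (z.length + 1))
    (h : (i : ℕ) + w.length ≤ z.length) :
    (w.map (pathMatrix z)).prod i (Fin.last _) = if w = z.drop i then 1 else 0 := by
  induction w generalizing i with
  | nil =>
    simp only [List.map_nil, List.prod_nil, Matrix.one_apply, Fin.ext_iff, Fin.val_last,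
      eq_comm (a := ([] : List _)), List.drop_eq_nil_iff]
    have := i.2
    congr 1
    simp only [eq_iff_iff]
    omega
  | cons x w ih =>
    simp only [List.map_cons, List.prod_cons, Matrix.mul_apply]
    simp only [List.length_cons] at h
    have hi : (i : ℕ) < z.length := by omega
    rw [Finset.sum_eq_single (⟨i + 1, by omega⟩ : Fin (z.length + 1))]
    · rw [ih _ (by simp; omega)]
      have hiff : x :: w = z.drop i ↔ z[(i : ℕ)] = x ∧ w = z.drop (i + 1) := by
        rw [List.drop_eq_getElem_cons hi, List.cons_eq_cons, eq_comm (a := x)]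
      simp only [hiff]
      have hne : ¬ ((i : ℕ) + 1 + 1 = i) := by omega
      simp [pathMatrix, hi, hne, ← ite_and, and_comm]
    · intro j _ hj
      by_cases hc : (j : ℕ) + 1 = i
      · rw [ih _ (by omega), if_neg, mul_zero]
        intro hw
        have := congrArg List.length hw
        simp at this
        omega
      · have : ¬ (i : ℕ) + 1 = j := fun h => hj (Fin.ext h.symm)
        simp [pathMatrix, hc, this]
    · simp

lemma prod_cutMatrix_pathMatrix_apply_last {μ k : ℕ} (z w : List (Fin μ ⊕ Fin μ))
    (hk₁ : 1 ≤ k) (hk : k < z.length) (i : Fin (z.length + 1))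
    (h : (w.map fun x => cutMatrix (fun j : Fin (z.length + 1) => 1 ≤ (j : ℕ) ∧ (j : ℕ) ≤ k)
      (pathMatrix z x)).prod i (Fin.last _) ≠ 0) :
    k < i ∧ z.length ≤ i + w.length := by
  induction w generalizing i with
  | nil =>
    simp [Matrix.one_apply] at h
    subst h
    simp [hk]
  | cons x w ih =>
    simp only [List.map_cons, List.prod_cons, Matrix.mul_apply] at h
    obtain ⟨j, -, hj⟩ := Finset.exists_ne_zero_of_sum_ne_zero h
    have h1 := ih j (right_ne_zero_of_mul hj)
    have h2 := left_ne_zero_of_mul hj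
    simp only [cutMatrix, pathMatrix, Matrix.of_apply, ne_eq, ite_eq_left_iff, ite_eq_right_iff,
      Classical.not_imp] at h2
    simp only [List.length_cons]
    omega

lemma prod_pathMatrix_sub_cutMatrix_apply_last {μ k : ℕ} (z w : List (Fin μ ⊕ Fin μ))
    (hk₁ : 1 ≤ k) (hk : k < z.length) (i : Fin (z.length + 1))
    (h : (w.map (pathMatrix z)).prod i (Fin.last _) -
      (w.map fun x => cutMatrix (fun j : Fin (z.length + 1) => 1 ≤ (j : ℕ) ∧ (j : ℕ) ≤ k)
      (pathMatrix z x)).prod i (Fin.last _) ≠ 0) :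
    (i : ℕ) + z.length ≤ w.length + 2 * k := by
  induction w generalizing i with
  | nil => simp at h
  | cons x w ih =>
    simp only [List.map_cons, List.prod_cons, Matrix.mul_apply, ← Finset.sum_sub_distrib] at h
    obtain ⟨j, -, hj⟩ := Finset.exists_ne_zero_of_sum_ne_zero h
    simp only [List.length_cons]
    set A := (w.map (pathMatrix z)).prod j (Fin.last _) with hA
    set B := (w.map fun x => cutMatrix (fun j : Fin (z.length + 1) => 1 ≤ (j : ℕ) ∧ (j : ℕ) ≤ k)
      (pathMatrix z x)).prod j (Fin.last _) with hB
    have hadj : pathMatrix z x i j ≠ 0 := by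
      intro h0
      apply hj
      simp [cutMatrix, h0]
    have hadj' : (i : ℕ) + 1 = j ∨ (j : ℕ) + 1 = i := by
      simp only [pathMatrix, Matrix.of_apply, ne_eq, ite_eq_right_iff, Classical.not_imp] at hadj
      omega
    by_cases hAB : A - B = 0
    · have hne : B ≠ 0 := by
        intro h0
        rw [h0, sub_zero] at hAB
        apply hj
        rw [hAB, h0]; simp
      have h1 := prod_cutMatrix_pathMatrix_apply_last z w hk₁ hk j hne
      have : (1 ≤ (i : ℕ) ∧ (i : ℕ) ≤ k) ∨ (1 ≤ (j : ℕ) ∧ (j : ℕ) ≤ k) := by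
        by_contra hc
        apply hj
        simp only [cutMatrix, Matrix.of_apply, if_neg hc, ← mul_sub, hAB, mul_zero]
      omega
    · have := ih j hAB
      omega

lemma coeff_eq_zero_of_isXYConvex {d μ : ℕ} {p : NCPoly d d μ} (hconv : IsXYConvex p)
    (z : List (Fin μ ⊕ Fin μ)) (hdeg : ∀ w, p w ≠ 0 → w.toList.length ≤ z.length) (k : ℕ)
    (hk₁ : 1 ≤ k) (hk : 2 * k < z.length) (hz : z.length < 2 * (z.length - k))
    (hside : 2 ≤ k ∨ ∃ a b, z[0]? = some a ∧ z[1]? = some b ∧ a.isLeft = b.isLeft) :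
    p (FreeMonoid.ofList z) = 0 := by
  classical
  ext s t
  set P : Fin (z.length + 1) → Prop := fun j => 1 ≤ (j : ℕ) ∧ (j : ℕ) ≤ k with hP
  let ι : {i // ¬ P i} → Fin (z.length + 1) := Subtype.val
  let a : {i // ¬ P i} := ⟨0, by simp [hP]⟩
  let b : {i // ¬ P i} := ⟨Fin.last _, by simp [hP]; omega⟩
  have hentry : ∀ (r q : Fin d) (i j : {i // ¬ P i}),
      defectEntry p ι (pathMatrix z) r i q j =
      p.sum fun w c => c r q * ((w.toList.map (pathMatrix z)).prod i j -
        (w.toList.map fun x => cutMatrix P (pathMatrix z x)).prod i j) := by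
    intro r q i j
    unfold defectEntry
    congr 1
    funext w c
    rw [Matrix.sub_apply, prod_map_submatrix_val]
    rfl
  have hbb : defectEntry p ι (pathMatrix z) t b t b = 0 := by
    rw [hentry]
    refine Finset.sum_eq_zero fun w hw => ?_
    have hlen := hdeg w (Finsupp.mem_support_iff.1 hw)
    refine mul_eq_zero_of_right _ ?_
    by_contra hne
    have := prod_pathMatrix_sub_cutMatrix_apply_last z w.toList hk₁ (by omega) b hne
    simp only [b, Fin.val_last] at this
    omega
  have hab : defectEntry p ι (pathMatrix z) s a t b =
      p (FreeMonoid.ofList z) s t := by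
    rw [hentry]
    have hterm : ∀ w ∈ p.support, p w s t * ((w.toList.map (pathMatrix z)).prod a b -
        (w.toList.map fun x => cutMatrix P (pathMatrix z x)).prod a b) =
        if w = FreeMonoid.ofList z then p w s t else 0 := by
      intro w hw
      have hlen := hdeg w (Finsupp.mem_support_iff.1 hw)
      have h0 : (w.toList.map fun x => cutMatrix P (pathMatrix z x)).prod a b = 0 := by
        by_contra hne
        have := prod_cutMatrix_pathMatrix_apply_last z w.toList hk₁ (by omega) a hne
        simp [a] at this
      have h1 := prod_pathMatrix_apply_last z w.toList a (by simpa [a] using hlen)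
      rw [h0, h1, sub_zero]
      have : w.toList = z.drop (a.val : ℕ) ↔ w = FreeMonoid.ofList z := by
        simp only [a, Fin.val_zero, List.drop_zero]
        exact Iff.rfl
      simp only [this, mul_ite, mul_one, mul_zero]
    rw [Finsupp.sum, Finset.sum_congr rfl hterm, Finset.sum_ite_eq']
    split_ifs with hmem
    · rfl
    · rw [Finsupp.notMem_support_iff.1 hmem]; rfl
  rw [← hab, Matrix.zero_apply]
  refine eq_zero_of_forall_affine_nonneg (y := defectEntry p ι
    (pathMatrix z) t b s a) (D := defectEntry p ι
    (pathMatrix z) s a s a) fun c => ?_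
  have hxy : ∀ i j : Fin μ, (pathMatrix z (.inl i) * pathMatrix z (.inr j)).submatrix
      ι ι =
      (pathMatrix z (.inl i)).submatrix ι ι *
        (pathMatrix z (.inr j)).submatrix ι ι := by
    intro i j
    ext u v
    simp only [Matrix.submatrix_apply, Matrix.mul_apply, ι]
    rw [← Fintype.sum_subtype_add_sum_subtype (fun c => ¬ P c)]
    simp only [add_eq_left]
    refine Finset.sum_eq_zero fun c _ => ?_
    have hc := c.2
    have hu := u.2
    have hv := v.2
    simp only [not_not] at hc
    by_contra hne
    have h1 := left_ne_zero_of_mul hne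
    have h2 := right_ne_zero_of_mul hne
    simp only [pathMatrix, Matrix.of_apply, ne_eq, ite_eq_right_iff, Classical.not_imp,
      one_ne_zero, not_false_eq_true, and_true] at h1 h2
    generalize c.val = c' at *
    generalize u.val = u' at *
    generalize v.val = v' at *
    simp only [hP] at hc hu hv
    have key : ∀ e f : ℕ, z[e]? = some (.inl i) → z[f]? = some (.inr j) → e ≠ f ∧
        ¬ (k = 1 ∧ e = 0 ∧ f = 1) ∧ ¬ (k = 1 ∧ e = 1 ∧ f = 0) := by
      intro e f he hf
      refine ⟨?_, ?_, ?_⟩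
      · rintro rfl
        simp [he] at hf
      all_goals
        rintro ⟨rfl, rfl, rfl⟩
        obtain h | ⟨x, y, hx, hy, hxy⟩ := hside
        · omega
        · simp_all
    rcases h1 with ⟨h1, h1'⟩ | ⟨h1, h1'⟩ <;> rcases h2 with ⟨h2, h2'⟩ | ⟨h2, h2'⟩ <;>
      obtain ⟨k1, k2, k3⟩ := key _ _ h1 h2 <;> omega
  have := defectForm_nonneg hconv ι Subtype.val_injective
    (pathMatrix z) (pathMatrix_isHermitian z) hxy
    (fun r i => (if r = s then if i = a then 1 else 0 else 0) +
        if r = t then if i = b then c else 0 else 0)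
  rw [defectForm_pair p _ _ s t a b c, hbb, mul_zero, add_zero] at this
  exact this

lemma length_le_four_of_isXYConvex {d μ : ℕ} {p : NCPoly d d μ} (hconv : IsXYConvex p)
    (w : FreeWord μ) (hw : p w ≠ 0) : w.toList.length ≤ 4 := by
  by_contra! hlen
  obtain ⟨u, hu, hmax⟩ := Finset.exists_max_image p.support (fun w => w.toList.length)
    ⟨w, Finsupp.mem_support_iff.2 hw⟩
  have h5 := hmax w (Finsupp.mem_support_iff.2 hw)
  exact Finsupp.mem_support_iff.1 hu (coeff_eq_zero_of_isXYConvex hconv u.toList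
    (fun v hv => hmax v (Finsupp.mem_support_iff.2 hv)) 2 (by omega) (by omega) (by omega)
    (.inl le_rfl))

lemma coeff_four_eq_zero_of_isXYConvex {d μ : ℕ} {p : NCPoly d d μ} (hconv : IsXYConvex p)
    (a b c e : Fin μ ⊕ Fin μ) (hab : a.isLeft = b.isLeft) :
    p (FreeMonoid.ofList [a, b, c, e]) = 0 :=
  coeff_eq_zero_of_isXYConvex hconv [a, b, c, e] (length_le_four_of_isXYConvex hconv) 1
    le_rfl (by simp) (by simp) (.inr ⟨a, b, rfl, rfl, hab⟩)

section Separation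

attribute [local instance] Matrix.normedAddCommGroup Matrix.normedSpace

variable {I : Type*}

lemma exists_conjTranspose_mul_self_of_posSemidef [Fintype I] [DecidableEq I] {A : Matrix I I ℂ} (hA : A.PosSemidef) :
    ∃ S : Matrix I I ℂ, A = Sᴴ * S := by
  open scoped MatrixOrder in
  exact CStarAlgebra.nonneg_iff_eq_star_mul_self.1 hA.nonneg

lemma sq_norm_entry_le_re_diag [Fintype I] (S : Matrix I I ℂ) (i j : I) :
    ‖S i j‖ ^ 2 ≤ ((Sᴴ * S) j j).re := by
  have : ((Sᴴ * S) j j).re = ∑ i, ‖S i j‖ ^ 2 := by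
    simp [Matrix.mul_apply, ← Complex.normSq_eq_norm_sq, Complex.normSq_apply]
  rw [this]
  exact Finset.single_le_sum (f := fun i => ‖S i j‖ ^ 2) (fun i _ => sq_nonneg _)
    (Finset.mem_univ i)

lemma isClosed_setOf_sub_conjTranspose_mul_self_mem [Fintype I] (W : Submodule ℂ (Matrix I I ℂ))
    (hdiag : ∀ w ∈ W, ∀ i, w i i = 0) :
    IsClosed {A : Matrix I I ℂ | ∃ S : Matrix I I ℂ, A - Sᴴ * S ∈ W} := by
  have : SequentialSpace (Matrix I I ℂ) := inferInstanceAs (SequentialSpace (I → I → ℂ))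
  refine IsSeqClosed.isClosed fun A B hA hAB => ?_
  choose S hS using hA
  obtain ⟨R, hR⟩ := (Metric.isBounded_range_of_tendsto A hAB).exists_norm_le
  have hbound : ∀ n, ‖S n‖ ≤ R + 1 := by
    intro n
    have hRn := hR (A n) ⟨n, rfl⟩
    have hR0 : 0 ≤ R := (norm_nonneg _).trans hRn
    rw [Matrix.norm_le_iff (by linarith)]
    intro i j
    have h1 := sq_norm_entry_le_re_diag (S n) i j
    have h2 := hdiag _ (hS n) j
    rw [Matrix.sub_apply, sub_eq_zero] at h2
    have h3 : ((S n)ᴴ * S n) j j = A n j j := h2.symm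
    rw [h3] at h1
    have h4 := (Complex.re_le_norm (A n j j)).trans ((Matrix.norm_entry_le_entrywise_sup_norm
      (A n)).trans hRn)
    nlinarith [norm_nonneg (S n i j)]
  obtain ⟨T, -, φ, hφ, hT⟩ := tendsto_subseq_of_bounded (s := Metric.closedBall 0 (R + 1))
    Metric.isBounded_closedBall (x := S) (fun n => by simpa using hbound n)
  refine ⟨T, ?_⟩
  have hW : IsClosed (W : Set (Matrix I I ℂ)) := W.closed_of_finiteDimensional
  refine hW.mem_of_tendsto (f := fun n => A (φ n) - (S (φ n))ᴴ * S (φ n)) (b := Filter.atTop) ?_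
    (Filter.Eventually.of_forall fun n => hS (φ n))
  have hcont : Continuous fun M : Matrix I I ℂ => Mᴴ * M := by fun_prop
  exact (hAB.comp hφ.tendsto_atTop).sub ((hcont.tendsto T).comp hT)

lemma convex_setOf_sub_conjTranspose_mul_self_mem [Fintype I] [DecidableEq I] (W : Submodule ℂ (Matrix I I ℂ)) :
    Convex ℝ {A : Matrix I I ℂ | ∃ S : Matrix I I ℂ, A - Sᴴ * S ∈ W} := by
  rintro A ⟨S, hS⟩ B ⟨T, hT⟩ a b ha hb -
  have h1 : ((a : ℂ) • (Sᴴ * S) + (b : ℂ) • (Tᴴ * T)).PosSemidef :=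
    ((Matrix.posSemidef_conjTranspose_mul_self S).smul (Complex.zero_le_real.2 ha)).add
      ((Matrix.posSemidef_conjTranspose_mul_self T).smul (Complex.zero_le_real.2 hb))
  obtain ⟨U, hU⟩ := exists_conjTranspose_mul_self_of_posSemidef h1
  refine ⟨U, ?_⟩
  have h2 := W.add_mem (W.smul_mem (a : ℂ) hS) (W.smul_mem (b : ℂ) hT)
  convert h2 using 1
  rw [← hU, ← Complex.coe_smul, ← Complex.coe_smul, smul_sub, smul_sub]
  abel

/-- The matrix representing a hermitian real-linear functional through the entrywise pairing. -/
noncomputable def functionalMatrix [DecidableEq I] (f : Matrix I I ℂ →ₗ[ℝ] ℝ) : Matrix I I ℂ :=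
  Matrix.of fun i j => (f (Matrix.single i j 1) : ℂ) - Complex.I * f (Matrix.single i j Complex.I)

lemma re_sum_mul_functionalMatrix [Fintype I] [DecidableEq I] (f : Matrix I I ℂ →ₗ[ℝ] ℝ) (A : Matrix I I ℂ) :
    (∑ i, ∑ j, A i j * functionalMatrix f i j).re = f A := by
  conv_rhs => rw [Matrix.matrix_eq_sum_single A]
  simp only [map_sum, Complex.re_sum]
  refine Finset.sum_congr rfl fun i _ => Finset.sum_congr rfl fun j _ => ?_
  have : Matrix.single i j (A i j) = (A i j).re • Matrix.single i j (1 : ℂ) +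
      (A i j).im • Matrix.single i j Complex.I := by
    rw [Matrix.smul_single, Matrix.smul_single, ← Matrix.single_add]
    congr 1
    simp [Complex.re_add_im]
  rw [this, map_add, map_smul, map_smul]
  simp [functionalMatrix]

lemma functionalMatrix_isHermitian [DecidableEq I] (f : Matrix I I ℂ →ₗ[ℝ] ℝ) (hf : ∀ A, f Aᴴ = f A) :
    (functionalMatrix f).IsHermitian := by
  ext i j
  have h1 : f (Matrix.single j i 1) = f (Matrix.single i j 1) := by
    rw [← hf, Matrix.conjTranspose_single, star_one]
  have h2 : f (Matrix.single j i Complex.I) = - f (Matrix.single i j Complex.I) := by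
    have h3 : star Complex.I = -Complex.I := Complex.conj_I
    rw [← hf, Matrix.conjTranspose_single, ← map_neg, h3, Matrix.single_neg]
  simp [functionalMatrix, Matrix.conjTranspose_apply, h1, h2, sub_eq_add_neg]

lemma functionalMatrix_posSemidef [Fintype I] [DecidableEq I] (f : Matrix I I ℂ →ₗ[ℝ] ℝ) (hf : ∀ A, f Aᴴ = f A)
    (hpos : ∀ S : Matrix I I ℂ, 0 ≤ f (Sᴴ * S)) : (functionalMatrix f).PosSemidef := by
  have hL := functionalMatrix_isHermitian f hf
  refine .of_dotProduct_mulVec_nonneg hL fun v => ?_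
  have him : (star v ⬝ᵥ functionalMatrix f *ᵥ v).im = 0 := hL.im_star_dotProduct_mulVec_self v
  rw [Complex.nonneg_iff]
  refine ⟨?_, him.symm⟩
  obtain ⟨S, hS⟩ := exists_conjTranspose_mul_self_of_posSemidef
    (Matrix.posSemidef_vecMulVec_star_self v)
  have h1 := hpos S
  rw [← hS, ← re_sum_mul_functionalMatrix] at h1
  convert h1 using 2
  simp only [dotProduct, Matrix.mulVec, Finset.mul_sum, Matrix.vecMulVec_apply]
  refine Finset.sum_congr rfl fun i _ => Finset.sum_congr rfl fun j _ => ?_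
  ring

theorem exists_sub_conjTranspose_mul_self_mem [Fintype I] [DecidableEq I] (W : Submodule ℂ (Matrix I I ℂ))
    (hstar : ∀ w ∈ W, wᴴ ∈ W) (hdiag : ∀ w ∈ W, ∀ i, w i i = 0) (G : Matrix I I ℂ)
    (hG : G - Gᴴ ∈ W)
    (hpos : ∀ L : Matrix I I ℂ, L.PosDef → (∀ w ∈ W, ∑ i, ∑ j, w i j * L i j = 0) →
      0 ≤ (∑ i, ∑ j, G i j * L i j).re) :
    ∃ S : Matrix I I ℂ, G - Sᴴ * S ∈ W := by
  by_contra hcon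
  have : LocallyConvexSpace ℝ (Matrix I I ℂ) :=
    inferInstanceAs (LocallyConvexSpace ℝ (I → I → ℂ))
  obtain ⟨f, u, hfG, hfK⟩ := geometric_hahn_banach_point_closed
    (convex_setOf_sub_conjTranspose_mul_self_mem W)
    (isClosed_setOf_sub_conjTranspose_mul_self_mem W hdiag) hcon
  have hu : u < 0 := by simpa using hfK 0 ⟨0, by simp⟩
  have hfG0 : f G < 0 := hfG.trans hu
  have hfW : ∀ w ∈ W, f w = 0 := by
    intro w hw
    by_contra hne
    have := hfK ((u / f w : ℝ) • w) ⟨0, by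
      rw [Matrix.mul_zero, sub_zero, ← Complex.coe_smul]
      exact W.smul_mem _ hw⟩
    rw [map_smul, smul_eq_mul, div_mul_cancel₀ _ hne] at this
    exact lt_irrefl _ this
  have hfS : ∀ S : Matrix I I ℂ, 0 ≤ f (Sᴴ * S) := by
    intro S
    by_contra! hlt
    have h0 : 0 ≤ u / f (Sᴴ * S) := div_nonneg_of_nonpos hu.le hlt.le
    have := hfK ((u / f (Sᴴ * S) : ℝ) • (Sᴴ * S)) ⟨((Real.sqrt (u / f (Sᴴ * S)) : ℝ) : ℂ) • S, by
      rw [Matrix.conjTranspose_smul, Matrix.smul_mul, Matrix.mul_smul, smul_smul]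
      simp only [Complex.star_def, Complex.conj_ofReal, ← Complex.ofReal_mul,
        Real.mul_self_sqrt h0, Complex.coe_smul, sub_self, W.zero_mem]⟩
    rw [map_smul, smul_eq_mul, div_mul_cancel₀ _ hlt.ne] at this
    exact lt_irrefl _ this
  let g : Matrix I I ℂ →ₗ[ℝ] ℝ :=
    { toFun := fun A => f A + f Aᴴ
      map_add' := fun A B => by simp only [Matrix.conjTranspose_add, map_add]; ring
      map_smul' := fun r A => by
        simp only [Matrix.conjTranspose_smul, map_smul, star_trivial, smul_eq_mul,
          RingHom.id_apply]
        ring }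
  have hg : ∀ A, g A = f A + f Aᴴ := fun _ => rfl
  have hgstar : ∀ A, g Aᴴ = g A := fun A => by
    rw [hg, hg, Matrix.conjTranspose_conjTranspose, add_comm]
  have hgS : ∀ S : Matrix I I ℂ, 0 ≤ g (Sᴴ * S) := fun S => by
    rw [hg, Matrix.conjTranspose_mul, Matrix.conjTranspose_conjTranspose]
    linarith [hfS S]
  have hgW : ∀ w ∈ W, g w = 0 := fun w hw => by rw [hg, hfW w hw, hfW _ (hstar w hw), add_zero]
  have hgG : g G < 0 := by
    have := hfW _ hG
    rw [map_sub] at this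
    rw [hg]
    linarith
  have hLpsd := functionalMatrix_posSemidef g hgstar hgS
  obtain ⟨δ, hδ, hδG⟩ : ∃ δ : ℝ, 0 < δ ∧ g G + δ * (∑ i, G i i).re < 0 := by
    refine ⟨-g G / (2 * (|(∑ i, G i i).re| + 1)), by
      apply div_pos <;> linarith [abs_nonneg (∑ i, G i i).re], ?_⟩
    have h1 := le_abs_self (∑ i, G i i).re
    have h2 := abs_nonneg (∑ i, G i i).re
    rw [div_mul_eq_mul_div, ← lt_neg_iff_add_neg', div_lt_iff₀ (by linarith)]
    nlinarith
  have hsum : ∀ A : Matrix I I ℂ, ∑ i, ∑ j, A i j * (functionalMatrix g + (δ : ℂ) • 1) i j =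
      (∑ i, ∑ j, A i j * functionalMatrix g i j) + δ * ∑ i, A i i := by
    intro A
    simp [mul_add, Finset.sum_add_distrib, Matrix.one_apply, Finset.mul_sum, mul_comm]
  have := hpos (functionalMatrix g + (δ : ℂ) • 1)
    (Matrix.PosDef.posSemidef_add hLpsd (Matrix.PosDef.one.smul (Complex.zero_lt_real.2 hδ))) ?_
  · rw [hsum, Complex.add_re, re_sum_mul_functionalMatrix, Complex.re_ofReal_mul] at this
    linarith
  · intro w hw
    rw [hsum, Finset.sum_eq_zero (f := fun i => w i i) fun i _ => hdiag w hw i, mul_zero, add_zero]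
    have h1 := re_sum_mul_functionalMatrix g w
    have h2 := re_sum_mul_functionalMatrix g (Complex.I • w)
    rw [hgW w hw] at h1
    rw [hgW _ (W.smul_mem _ hw)] at h2
    simp only [Matrix.smul_apply, smul_eq_mul, mul_assoc, ← Finset.mul_sum, Complex.I_mul_re,
      neg_eq_zero] at h2
    exact Complex.ext h1 h2

end Separation

section Model

variable {d μ : ℕ}

/-- Indices of the Gram matrix of the words of length one and two, tensored with `ℂ^d`. -/
abbrev GramIndex (d μ : ℕ) :=
  ((Fin μ ⊕ Fin μ) ⊕ (Fin μ ⊕ Fin μ) × (Fin μ ⊕ Fin μ)) × Fin d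

/-- The compatibility conditions on a Gram matrix which allow to read off an `xy`-pair from it. -/
structure IsCompatibleGram (L : Matrix (GramIndex d μ) (GramIndex d μ) ℂ) : Prop where
  mixed : ∀ a b s t, a.isLeft ≠ b.isLeft → L (.inl a, s) (.inl b, t) = 0
  shift : ∀ a b c s t, L (.inl a, s) (.inr (b, c), t) = L (.inr (b, a), s) (.inl c, t)

/-- The hermitian form of multiplication by the letter `a` with respect to the Gram matrix `L`. -/
def shiftForm (L : Matrix (GramIndex d μ) (GramIndex d μ) ℂ) (a : Fin μ ⊕ Fin μ) :
    Matrix (GramIndex d μ) (GramIndex d μ) ℂ :=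
  Matrix.of fun i j => match i, j with
    | (.inl z, s), (.inl z', t) => L (.inl z, s) (.inr (a, z'), t)
    | (.inl z, s), (.inr x, t) => L (.inr (a, z), s) (.inr x, t)
    | (.inr x, s), (.inl z, t) => L (.inr x, s) (.inr (a, z), t)
    | (.inr _, _), (.inr _, _) => 0

lemma shiftForm_isHermitian {L : Matrix (GramIndex d μ) (GramIndex d μ) ℂ} (hL : L.IsHermitian)
    (hc : IsCompatibleGram L) (a : Fin μ ⊕ Fin μ) : (shiftForm L a).IsHermitian := by
  ext ⟨i, s⟩ ⟨j, t⟩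
  rcases i with z | x <;> rcases j with z' | x' <;>
    simp only [shiftForm, Matrix.conjTranspose_apply, Matrix.of_apply, star_zero, hL.apply]
  rw [hc.shift]

lemma shiftForm_submatrix (L : Matrix (GramIndex d μ) (GramIndex d μ) ℂ)
    (a z : Fin μ ⊕ Fin μ) :
    (shiftForm L a).submatrix id (fun t => (.inl z, t)) =
      L.submatrix id (fun t => (.inr (a, z), t)) := by
  ext ⟨i, s⟩ t
  rcases i with z' | x <;> rfl

lemma exists_shift_of_isCompatibleGram {L : Matrix (GramIndex d μ) (GramIndex d μ) ℂ}
    (hL : L.PosDef) (hc : IsCompatibleGram L) :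
    ∃ (R : Matrix (GramIndex d μ) (GramIndex d μ) ℂ)
      (C : Fin μ ⊕ Fin μ → Matrix (GramIndex d μ) (GramIndex d μ) ℂ), L = Rᴴ * R ∧
      (∀ a, (C a).IsHermitian) ∧ ∀ a z, C a * R.submatrix id (fun t => (.inl z, t)) =
        R.submatrix id (fun t => (.inr (a, z), t)) := by
  obtain ⟨R, hR⟩ := exists_conjTranspose_mul_self_of_posSemidef hL.posSemidef
  have hRu : IsUnit R.det := by
    have h1 := hL.det_pos.ne'
    rw [hR, Matrix.det_mul] at h1
    exact isUnit_iff_ne_zero.2 (right_ne_zero_of_mul h1)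
  refine ⟨R, fun a => (R⁻¹)ᴴ * shiftForm L a * R⁻¹, hR, fun a => ?_, fun a z => ?_⟩
  · exact Matrix.isHermitian_conjTranspose_mul_mul _ (shiftForm_isHermitian hL.1 hc a)
  · have h1 : ∀ (A B : Matrix (GramIndex d μ) (GramIndex d μ) ℂ) (f : Fin d → GramIndex d μ),
        A * B.submatrix id f = (A * B).submatrix id f := fun A B f => rfl
    rw [h1, Matrix.mul_assoc, Matrix.nonsing_inv_mul _ hRu, Matrix.mul_one, ← h1,
      shiftForm_submatrix, h1, hR, ← Matrix.mul_assoc, ← Matrix.conjTranspose_mul,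
      Matrix.mul_nonsing_inv _ hRu, Matrix.conjTranspose_one, Matrix.one_mul]

/-- The tuple acting on `ℂ^d ⊕ ℂ^I` whose compression to `ℂ^d` vanishes. -/
def modelTuple (R : Matrix (GramIndex d μ) (GramIndex d μ) ℂ)
    (C : Fin μ ⊕ Fin μ → Matrix (GramIndex d μ) (GramIndex d μ) ℂ) (a : Fin μ ⊕ Fin μ) :
    Matrix (Fin d ⊕ GramIndex d μ) (Fin d ⊕ GramIndex d μ) ℂ :=
  Matrix.fromBlocks 0 (R.submatrix id fun t => (.inl a, t))ᴴ (R.submatrix id fun t => (.inl a, t))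
    (C a)

lemma modelTuple_isHermitian (R : Matrix (GramIndex d μ) (GramIndex d μ) ℂ)
    (C : Fin μ ⊕ Fin μ → Matrix (GramIndex d μ) (GramIndex d μ) ℂ) (hC : ∀ a, (C a).IsHermitian)
    (a : Fin μ ⊕ Fin μ) : (modelTuple R C a).IsHermitian :=
  Matrix.IsHermitian.fromBlocks Matrix.isHermitian_zero
    (Matrix.conjTranspose_conjTranspose _) (hC a)

lemma modelTuple_submatrix (R : Matrix (GramIndex d μ) (GramIndex d μ) ℂ)
    (C : Fin μ ⊕ Fin μ → Matrix (GramIndex d μ) (GramIndex d μ) ℂ) (a : Fin μ ⊕ Fin μ) :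
    (modelTuple R C a).submatrix Sum.inl Sum.inl = 0 := rfl

lemma submatrix_conjTranspose_mul_submatrix {k l m : Type*} [Fintype k]
    (R : Matrix k k ℂ) (f : l → k) (g : m → k) :
    (R.submatrix id f)ᴴ * R.submatrix id g = (Rᴴ * R).submatrix f g := rfl

/-- The compression defects of words of length at most four on the model tuple. -/
lemma modelTuple_defect {L R : Matrix (GramIndex d μ) (GramIndex d μ) ℂ}
    {C : Fin μ ⊕ Fin μ → Matrix (GramIndex d μ) (GramIndex d μ) ℂ}
    (hR : L = Rᴴ * R) (hC : ∀ a, (C a).IsHermitian)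
    (hCR : ∀ a z, C a * R.submatrix id (fun t => (.inl z, t)) =
        R.submatrix id (fun t => (.inr (a, z), t))) :
    (∀ a b, (modelTuple R C a * modelTuple R C b).submatrix Sum.inl Sum.inl =
      L.submatrix (fun s => (.inl a, s)) (fun t => (.inl b, t))) ∧
    (∀ a b c, (modelTuple R C a * (modelTuple R C b * modelTuple R C c)).submatrix
        Sum.inl Sum.inl = L.submatrix (fun s => (.inl a, s)) (fun t => (.inr (b, c), t))) ∧
    (∀ a b c e, (modelTuple R C a * (modelTuple R C b * (modelTuple R C c *
        modelTuple R C e))).submatrix Sum.inl Sum.inl =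
      L.submatrix (fun s => (.inl a, s)) (fun t => (.inl b, t)) *
        L.submatrix (fun s => (.inl c, s)) (fun t => (.inl e, t)) +
      L.submatrix (fun s => (.inr (b, a), s)) (fun t => (.inr (c, e), t))) := by
  have hsub : ∀ M : Matrix (Fin d ⊕ GramIndex d μ) (Fin d ⊕ GramIndex d μ) ℂ,
      M.submatrix Sum.inl Sum.inl = M.toBlocks₁₁ := fun _ => rfl
  refine ⟨fun a b => ?_, fun a b c => ?_, fun a b c e => ?_⟩
  · rw [hsub, modelTuple, modelTuple, Matrix.fromBlocks_multiply, Matrix.toBlocks_fromBlocks₁₁,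
      submatrix_conjTranspose_mul_submatrix, ← hR, Matrix.zero_mul, zero_add]
  · rw [hsub, modelTuple, modelTuple, modelTuple, Matrix.fromBlocks_multiply,
      Matrix.fromBlocks_multiply, Matrix.toBlocks_fromBlocks₁₁, hCR,
      Matrix.zero_mul, zero_add, Matrix.mul_zero, zero_add, submatrix_conjTranspose_mul_submatrix, ← hR]
  · have h1 : (R.submatrix id fun t => (Sum.inl a, t))ᴴ * C b =
        (R.submatrix id fun t => (Sum.inr (b, a), t))ᴴ := by
      rw [← hCR, Matrix.conjTranspose_mul, (hC b).eq]
    rw [← Matrix.mul_assoc, hsub, modelTuple, modelTuple, modelTuple, modelTuple,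
      Matrix.fromBlocks_multiply, Matrix.fromBlocks_multiply, Matrix.fromBlocks_multiply,
      Matrix.toBlocks_fromBlocks₁₁]
    simp only [Matrix.zero_mul, Matrix.mul_zero, zero_add, hCR, h1,
      submatrix_conjTranspose_mul_submatrix, ← hR]

/-- The factorisation of words of length two to four into a reversed half and a half. -/
def gramWord {α : Type*} : α ⊕ α × α → α ⊕ α × α → Option (List α)
  | .inl a, .inl b => some [a, b]
  | .inl a, .inr (b, c) => some [a, b, c]
  | .inr _, .inl _ => none
  | .inr (b, a), .inr (c, e) => some [a, b, c, e]

lemma sum_gramWord {α M : Type*} [Fintype α] [DecidableEq α] [AddCommMonoid M]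
    (F : α ⊕ α × α → α ⊕ α × α → M) (w : List α) :
    ∑ m, ∑ m', (if gramWord m m' = some w then F m m' else 0) = match w with
      | [a, b] => F (.inl a) (.inl b)
      | [a, b, c] => F (.inl a) (.inr (b, c))
      | [a, b, c, e] => F (.inr (b, a)) (.inr (c, e))
      | _ => 0 := by
  rcases w with - | ⟨a, - | ⟨b, - | ⟨x, - | ⟨y, - | ⟨z, w⟩⟩⟩⟩⟩ <;>
    simp [gramWord, Fintype.sum_prod_type, ite_and, Finset.sum_ite_irrel]

/-- A matrix representing `p` modulo pencils through the words of length one and two. -/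
noncomputable def gramCoeff (p : NCPoly d d μ) : Matrix (GramIndex d μ) (GramIndex d μ) ℂ :=
  Matrix.of fun i j => (gramWord i.1 j.1).elim 0 fun w => p (FreeMonoid.ofList w) i.2 j.2

lemma sum_mul_defect_eq {L R : Matrix (GramIndex d μ) (GramIndex d μ) ℂ}
    {C : Fin μ ⊕ Fin μ → Matrix (GramIndex d μ) (GramIndex d μ) ℂ}
    (hR : L = Rᴴ * R) (hC : ∀ a, (C a).IsHermitian)
    (hCR : ∀ a z, C a * R.submatrix id (fun t => (.inl z, t)) =
        R.submatrix id (fun t => (.inr (a, z), t))) (hc : IsCompatibleGram L)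
    (c : Matrix (Fin d) (Fin d) ℂ) (w : List (Fin μ ⊕ Fin μ)) (hw : w.length ≤ 4)
    (hcw : ∀ a b x y, w = [a, b, x, y] → a.isLeft = b.isLeft → c = 0) :
    ∑ s, ∑ t, c s t * (((w.map (modelTuple R C)).prod).submatrix Sum.inl Sum.inl -
      (w.map fun x => (modelTuple R C x).submatrix Sum.inl Sum.inl).prod) s t =
    ∑ m, ∑ m', if gramWord m m' = some w then ∑ s, ∑ t, c s t * L (m, s) (m', t) else 0 := by
  obtain ⟨h2, h3, h4⟩ := modelTuple_defect hR hC hCR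
  rw [sum_gramWord fun m m' => ∑ s, ∑ t, c s t * L (m, s) (m', t)]
  rcases w with - | ⟨a, - | ⟨b, - | ⟨x, - | ⟨y, - | ⟨z, w⟩⟩⟩⟩⟩
  · simp [Matrix.submatrix_one _ Sum.inl_injective]
  · simp [modelTuple_submatrix]
  · simp [modelTuple_submatrix, h2]
  · simp [modelTuple_submatrix, h3]
  · have h5 : ∀ s t, c s t * (L.submatrix (fun s => (.inl a, s)) (fun t => (.inl b, t)) *
        L.submatrix (fun s => (.inl x, s)) (fun t => (.inl y, t))) s t = 0 := by
      intro s t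
      by_cases hab : a.isLeft = b.isLeft
      · rw [hcw a b x y rfl hab, Matrix.zero_apply, zero_mul]
      · have : L.submatrix (fun s : Fin d => (.inl a, s)) (fun t : Fin d => (.inl b, t)) = 0 := by
          ext s t
          exact hc.mixed a b s t hab
        rw [this, Matrix.zero_mul, Matrix.zero_apply, mul_zero]
    simp [modelTuple_submatrix, h4, mul_add, h5]
  · simp only [List.length_cons] at hw
    omega

lemma sum_gramCoeff_mul_nonneg {p : NCPoly d d μ} (hconv : IsXYConvex p)
    {L : Matrix (GramIndex d μ) (GramIndex d μ) ℂ} (hL : L.PosDef) (hc : IsCompatibleGram L) :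
    0 ≤ ∑ i, ∑ j, gramCoeff p i j * L i j := by
  obtain ⟨R, C, hR, hC, hCR⟩ := exists_shift_of_isCompatibleGram hL hc
  have h2 := (modelTuple_defect hR hC hCR).1
  refine (defectForm_nonneg hconv Sum.inl Sum.inl_injective (modelTuple R C)
    (modelTuple_isHermitian R C hC) (fun i j => ?_)
    (fun s a => if s = a then 1 else 0)).trans_eq ?_
  · rw [h2, modelTuple_submatrix, Matrix.zero_mul]
    ext s t
    exact hc.mixed _ _ s t (by simp)
  · have h1 : ∀ w ∈ p.support, ∑ s, ∑ a, ∑ t, ∑ b, star (if s = a then 1 else 0) * (p w s t *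
        (((w.toList.map (modelTuple R C)).prod).submatrix Sum.inl Sum.inl -
        (w.toList.map fun x => (modelTuple R C x).submatrix Sum.inl Sum.inl).prod) a b) *
        (if t = b then 1 else 0) = ∑ m, ∑ m', if gramWord m m' = some w.toList then
          ∑ s, ∑ t, p w s t * L (m, s) (m', t) else 0 := by
      intro w hw
      have hw' := Finsupp.mem_support_iff.1 hw
      rw [← sum_mul_defect_eq hR hC hCR hc (p w) w.toList (length_le_four_of_isXYConvex hconv w hw')
        fun a b x y hwl hab => by
          have := coeff_four_eq_zero_of_isXYConvex hconv a b x y hab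
          rwa [← hwl] at this]
      simp only [apply_ite star, star_one, star_zero, ite_mul, mul_ite, one_mul, zero_mul, mul_one,
        mul_zero, Finset.sum_ite_eq, Finset.sum_ite_irrel, Finset.sum_const_zero, Finset.mem_univ,
        if_true]
    unfold defectForm Finsupp.sum
    rw [Finset.sum_congr rfl h1, Finset.sum_comm, Fintype.sum_prod_type]
    refine Finset.sum_congr rfl fun m _ => ?_
    rw [Finset.sum_comm]
    simp only [Fintype.sum_prod_type]
    conv_rhs => rw [Finset.sum_comm]
    refine Finset.sum_congr rfl fun m' _ => ?_
    rcases hm : gramWord m m' with - | u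
    · simp [gramCoeff, hm]
    · rw [Finset.sum_eq_single (FreeMonoid.ofList u)]
      · simp [gramCoeff, hm]
      · intro w _ hw
        rw [if_neg fun h => hw ?_]
        rw [Option.some_inj] at h
        rw [h, FreeMonoid.ofList_toList]
      · intro hu
        simp [Finsupp.notMem_support_iff.1 hu]

end Model

section PolynomialCalculus

lemma polyStar_apply {N d μ : ℕ} (p : NCPoly N d μ) (w : List (Fin μ ⊕ Fin μ)) :
    polyStar p (FreeMonoid.ofList w) = (p (FreeMonoid.ofList w.reverse))ᴴ := by
  have hinj : Function.Injective
      (fun w : FreeWord μ => (FreeMonoid.ofList w.toList.reverse : FreeWord μ)) := by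
    intro u v huv
    exact List.reverse_injective huv
  have h := Finsupp.mapDomain_apply hinj
    (Finsupp.mapRange Matrix.conjTranspose (by simp) p) (FreeMonoid.ofList w.reverse)
  simpa [polyStar] using h

lemma polyStar_eq_self_iff {d μ : ℕ} (p : NCPoly d d μ) :
    polyStar p = p ↔
      ∀ w : List (Fin μ ⊕ Fin μ), (p (FreeMonoid.ofList w.reverse))ᴴ = p (FreeMonoid.ofList w) := by
  refine ⟨fun h w => by rw [← polyStar_apply, h], fun h => Finsupp.ext fun w => ?_⟩
  exact (polyStar_apply p w.toList).trans (h _)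

lemma polyStar_sum_single {N d μ : ℕ} {ι : Type*} [Fintype ι] (u : ι → List (Fin μ ⊕ Fin μ))
    (A : ι → Matrix (Fin N) (Fin d) ℂ) :
    polyStar (∑ i, Finsupp.single (FreeMonoid.ofList (u i)) (A i)) =
      ∑ i, Finsupp.single (FreeMonoid.ofList (u i).reverse) (A i)ᴴ := by
  classical
  ext1 w
  refine (polyStar_apply _ w.toList).trans ?_
  rw [Finsupp.finsetSum_apply, Finsupp.finsetSum_apply, Matrix.conjTranspose_sum]
  refine Finset.sum_congr rfl fun i _ => ?_
  have h : FreeMonoid.ofList (u i) = FreeMonoid.ofList w.toList.reverse ↔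
      FreeMonoid.ofList (u i).reverse = w :=
    (List.reverse_eq_iff (as := u i) (bs := w.toList)).symm
  rw [Finsupp.single_apply, Finsupp.single_apply]
  simp only [h]
  split_ifs <;> simp

lemma polyMul_sum_single {a b c μ : ℕ} {ι κ : Type*} [Fintype ι] [Fintype κ]
    (u : ι → FreeWord μ) (v : κ → FreeWord μ) (A : ι → Matrix (Fin a) (Fin b) ℂ)
    (B : κ → Matrix (Fin b) (Fin c) ℂ) :
    polyMul (∑ i, Finsupp.single (u i) (A i)) (∑ j, Finsupp.single (v j) (B j)) =
      ∑ i, ∑ j, Finsupp.single (u i * v j) (A i * B j) := by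
  unfold polyMul
  rw [← Finsupp.sum_finsetSum_index]
  · refine Finset.sum_congr rfl fun i _ => ?_
    rw [Finsupp.sum_single_index]
    · rw [← Finsupp.sum_finsetSum_index]
      · refine Finset.sum_congr rfl fun j _ => ?_
        rw [Finsupp.sum_single_index]
        simp
      · simp
      · intro w x y
        rw [Matrix.mul_add, Finsupp.single_add]
    · simp
  · simp
  · intro w x y
    rw [← Finsupp.sum_add]
    simp only [Matrix.add_mul, Finsupp.single_add]

end PolynomialCalculus

section Representation

variable {d μ : ℕ}

/-- The matrices which contribute only pencil terms through the words of length one and two. -/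
def gramNull (d μ : ℕ) : Submodule ℂ (Matrix (GramIndex d μ) (GramIndex d μ) ℂ) where
  carrier := {G | (∀ a b s t, a.isLeft = b.isLeft → G (.inl a, s) (.inl b, t) = 0) ∧
    (∀ a b c s t, G (.inl a, s) (.inr (b, c), t) + G (.inr (b, a), s) (.inl c, t) = 0) ∧
    ∀ x y s t, G (.inr x, s) (.inr y, t) = 0}
  add_mem' := by
    rintro G H ⟨hG1, hG2, hG3⟩ ⟨hH1, hH2, hH3⟩
    refine ⟨fun a b s t h => ?_, fun a b c s t => ?_, fun x y s t => ?_⟩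
    · rw [Matrix.add_apply, hG1 a b s t h, hH1 a b s t h, add_zero]
    · rw [Matrix.add_apply, Matrix.add_apply]
      linear_combination hG2 a b c s t + hH2 a b c s t
    · rw [Matrix.add_apply, hG3, hH3, add_zero]
  zero_mem' := ⟨fun _ _ _ _ _ => rfl, fun _ _ _ _ _ => add_zero 0, fun _ _ _ _ => rfl⟩
  smul_mem' := by
    rintro r G ⟨hG1, hG2, hG3⟩
    refine ⟨fun a b s t h => ?_, fun a b c s t => ?_, fun x y s t => ?_⟩
    · rw [Matrix.smul_apply, hG1 a b s t h, smul_zero]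
    · rw [Matrix.smul_apply, Matrix.smul_apply, ← smul_add, hG2, smul_zero]
    · rw [Matrix.smul_apply, hG3, smul_zero]

lemma conjTranspose_mem_gramNull {G : Matrix (GramIndex d μ) (GramIndex d μ) ℂ}
    (hG : G ∈ gramNull d μ) : Gᴴ ∈ gramNull d μ := by
  obtain ⟨h1, h2, h3⟩ := hG
  refine ⟨fun a b s t h => ?_, fun a b c s t => ?_, fun x y s t => ?_⟩
  · rw [Matrix.conjTranspose_apply, h1 b a t s h.symm, star_zero]
  · rw [Matrix.conjTranspose_apply, Matrix.conjTranspose_apply, ← star_add, add_comm, h2,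
      star_zero]
  · rw [Matrix.conjTranspose_apply, h3, star_zero]

lemma diag_eq_zero_of_mem_gramNull {G : Matrix (GramIndex d μ) (GramIndex d μ) ℂ}
    (hG : G ∈ gramNull d μ) (i : GramIndex d μ) : G i i = 0 := by
  obtain ⟨a | x, s⟩ := i
  · exact hG.1 a a s s rfl
  · exact hG.2.2 x x s s

lemma isCompatibleGram_of_orthogonal {L : Matrix (GramIndex d μ) (GramIndex d μ) ℂ}
    (hL : ∀ G ∈ gramNull d μ, ∑ i, ∑ j, G i j * L i j = 0) : IsCompatibleGram L := by
  have hsingle : ∀ i j, ∑ k, ∑ l, Matrix.single i j (1 : ℂ) k l * L k l = L i j := by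
    intro i j
    simp [Matrix.single_apply, ite_and]
  refine ⟨fun a b s t hab => ?_, fun a b c s t => ?_⟩
  · rw [← hsingle]
    refine hL _ ⟨fun a' b' s' t' h => ?_, fun a' b' c' s' t' => ?_, fun x y s' t' => ?_⟩
    · refine Matrix.single_apply_of_ne _ _ _ _ _ ?_
      rintro ⟨h1, h2⟩
      simp only [Prod.mk.injEq, Sum.inl.injEq] at h1 h2
      rw [h1.1, h2.1] at hab
      exact hab h
    · simp
    · simp
  · have h := hL (Matrix.single (.inl a, s) (.inr (b, c), t) 1 -
      Matrix.single (.inr (b, a), s) (.inl c, t) 1)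
      ⟨fun a' b' s' t' h => by simp,
        fun a' b' c' s' t' => by
          simp only [Matrix.sub_apply, Matrix.single_apply, Prod.mk.injEq, Sum.inl.injEq,
            Sum.inr.injEq, reduceCtorEq, false_and, and_false, if_false, sub_zero, zero_sub]
          rw [add_neg_eq_zero]
          congr 1
          simp only [eq_iff_iff]
          tauto,
        fun x y s' t' => by simp⟩
    simp only [Matrix.sub_apply, sub_mul, Finset.sum_sub_distrib, hsingle] at h
    exact sub_eq_zero.1 h

lemma gramCoeff_sub_conjTranspose_mem {p : NCPoly d d μ} (hherm : polyStar p = p) :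
    gramCoeff p - (gramCoeff p)ᴴ ∈ gramNull d μ := by
  rw [polyStar_eq_self_iff] at hherm
  have h : ∀ w s t, star (p (FreeMonoid.ofList w.reverse) s t) = p (FreeMonoid.ofList w) t s := by
    intro w s t
    rw [← hherm w, Matrix.conjTranspose_apply]
  refine ⟨fun a b s t _ => ?_, fun a b c s t => ?_, fun x y s t => ?_⟩
  · have := h [a, b] t s
    simp only [gramCoeff, gramWord, Matrix.sub_apply, Matrix.conjTranspose_apply,
      Matrix.of_apply, Option.elim_some]
    rw [sub_eq_zero]
    exact this.symm
  · have := h [a, b, c] t s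
    simp only [gramCoeff, gramWord, Matrix.sub_apply, Matrix.conjTranspose_apply,
      Matrix.of_apply, Option.elim_some, Option.elim_none, star_zero, sub_zero, zero_sub]
    rw [add_neg_eq_zero]
    exact this.symm
  · have := h [x.2, x.1, y.1, y.2] t s
    simp only [gramCoeff, gramWord, Matrix.sub_apply, Matrix.conjTranspose_apply,
      Matrix.of_apply, Option.elim_some]
    rw [sub_eq_zero]
    exact this.symm

lemma exists_gramCoeff_sub_mem {p : NCPoly d d μ} (hherm : polyStar p = p)
    (hconv : IsXYConvex p) :
    ∃ S : Matrix (GramIndex d μ) (GramIndex d μ) ℂ, gramCoeff p - Sᴴ * S ∈ gramNull d μ :=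
  exists_sub_conjTranspose_mul_self_mem _ (fun _ => conjTranspose_mem_gramNull)
    (fun _ => diag_eq_zero_of_mem_gramNull) _ (gramCoeff_sub_conjTranspose_mem hherm)
    fun _ hL hW => (Complex.nonneg_iff.1 (sum_gramCoeff_mul_nonneg hconv hL
      (isCompatibleGram_of_orthogonal hW))).1

/-- The word of length one or two with the given index. -/
def halfWord {α : Type*} : α ⊕ α × α → List α
  | .inl a => [a]
  | .inr (a, b) => [a, b]

lemma sum_halfWord {α M : Type*} [Fintype α] [DecidableEq α] [AddCommMonoid M]
    (F : α ⊕ α × α → α ⊕ α × α → M) (w : List α) :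
    ∑ m, ∑ m', (if (halfWord m).reverse ++ halfWord m' = w then F m m' else 0) = match w with
      | [a, b] => F (.inl a) (.inl b)
      | [a, b, c] => F (.inl a) (.inr (b, c)) + F (.inr (b, a)) (.inl c)
      | [a, b, c, e] => F (.inr (b, a)) (.inr (c, e))
      | _ => 0 := by
  rcases w with - | ⟨a, - | ⟨b, - | ⟨x, - | ⟨y, - | ⟨z, w⟩⟩⟩⟩⟩ <;>
    simp [halfWord, Fintype.sum_prod_type, ite_and, Finset.sum_ite_irrel]

lemma conjTranspose_mul_self_submatrix {m n l k : Type*} [Fintype m] [Fintype n] (e : n ≃ m)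
    (S : Matrix m m ℂ) (f : l → m) (g : k → m) :
    (S.submatrix e f)ᴴ * S.submatrix e g = (Sᴴ * S).submatrix f g := by
  rw [Matrix.conjTranspose_submatrix, Matrix.submatrix_mul_equiv]

/-- The polynomial with coefficients the columns of `S`. -/
noncomputable def halfPoly (S : Matrix (GramIndex d μ) (GramIndex d μ) ℂ) :
    NCPoly (Fintype.card (GramIndex d μ)) d μ :=
  ∑ m, Finsupp.single (FreeMonoid.ofList (halfWord m))
    (S.submatrix (Fintype.equivFin (GramIndex d μ)).symm fun t => (m, t))

lemma polyMul_polyStar_halfPoly_apply (S : Matrix (GramIndex d μ) (GramIndex d μ) ℂ)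
    (w : List (Fin μ ⊕ Fin μ)) :
    polyMul (polyStar (halfPoly S)) (halfPoly S) (FreeMonoid.ofList w) =
      ∑ m, ∑ m', if (halfWord m).reverse ++ halfWord m' = w then
        (Sᴴ * S).submatrix (fun s : Fin d => (m, s)) (fun t : Fin d => (m', t)) else 0 := by
  classical
  rw [halfPoly, polyStar_sum_single, polyMul_sum_single]
  simp only [Finsupp.finsetSum_apply, conjTranspose_mul_self_submatrix, ← FreeMonoid.ofList_append,
    Finsupp.single_apply, FreeMonoid.ofList.apply_eq_iff_eq]

lemma polyStar_polyMul_polyStar_halfPoly (S : Matrix (GramIndex d μ) (GramIndex d μ) ℂ) :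
    polyStar (polyMul (polyStar (halfPoly S)) (halfPoly S)) =
      polyMul (polyStar (halfPoly S)) (halfPoly S) := by
  rw [polyStar_eq_self_iff]
  intro w
  rw [polyMul_polyStar_halfPoly_apply, polyMul_polyStar_halfPoly_apply, Finset.sum_comm,
    Matrix.conjTranspose_sum]
  refine Finset.sum_congr rfl fun m _ => ?_
  rw [Matrix.conjTranspose_sum]
  refine Finset.sum_congr rfl fun m' _ => ?_
  have h : (halfWord m').reverse ++ halfWord m = w.reverse ↔
      (halfWord m).reverse ++ halfWord m' = w := by
    rw [← List.reverse_inj]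
    simp
  simp only [h]
  split_ifs
  · rw [Matrix.conjTranspose_submatrix, Matrix.conjTranspose_mul, Matrix.conjTranspose_conjTranspose]
  · simp

lemma isXYPencil_halfPoly {p : NCPoly d d μ} (hconv : IsXYConvex p)
    {S : Matrix (GramIndex d μ) (GramIndex d μ) ℂ} (hS : gramCoeff p - Sᴴ * S ∈ gramNull d μ) :
    IsXYPencil (halfPoly S) := by
  classical
  intro w hw
  rw [halfPoly, Finsupp.finsetSum_apply] at hw
  obtain ⟨m, -, hm⟩ := Finset.exists_ne_zero_of_sum_ne_zero hw
  rw [Finsupp.single_apply] at hm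
  split_ifs at hm with hmw
  · subst hmw
    rcases m with a | ⟨a, b⟩
    · rcases a with a | a <;> simp [halfWord, degX, degY, List.filter_cons]
    · by_cases hab : a.isLeft = b.isLeft
      · refine absurd ?_ hm
        ext i t
        have h1 := hS.2.2 (a, b) (a, b) t t
        have h2 : gramCoeff p (.inr (a, b), t) (.inr (a, b), t) = 0 := by
          have := coeff_four_eq_zero_of_isXYConvex hconv b a a b hab.symm
          exact congrFun (congrFun this t) t
        rw [Matrix.sub_apply, h2, zero_sub, neg_eq_zero] at h1
        have h3 := sq_norm_entry_le_re_diag S ((Fintype.equivFin (GramIndex d μ)).symm i)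
          (.inr (a, b), t)
        rw [h1, Complex.zero_re] at h3
        exact norm_eq_zero.1 (pow_eq_zero_iff two_ne_zero |>.1 (h3.antisymm (sq_nonneg _)))
      · rcases a with a | a <;> rcases b with b | b <;> simp [halfWord, degX, degY, List.filter_cons] at hab ⊢
  · exact absurd rfl hm

lemma isXYPencil_sub_halfPoly {p : NCPoly d d μ} (hconv : IsXYConvex p)
    {S : Matrix (GramIndex d μ) (GramIndex d μ) ℂ} (hS : gramCoeff p - Sᴴ * S ∈ gramNull d μ) :
    IsXYPencil (p - polyMul (polyStar (halfPoly S)) (halfPoly S)) := by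
  intro w
  obtain ⟨h1, h2, h3⟩ := hS
  induction w using FreeMonoid.ofList.surjective.forall.2 with | _ w => ?_
  rw [Finsupp.sub_apply, polyMul_polyStar_halfPoly_apply, sum_halfWord fun m m' =>
    (Sᴴ * S).submatrix (fun s : Fin d => (m, s)) (fun t : Fin d => (m', t))]
  rcases w with - | ⟨a, - | ⟨b, - | ⟨x, - | ⟨y, - | ⟨z, w⟩⟩⟩⟩⟩
  · simp [degX, degY]
  · rcases a with a | a <;> simp [degX, degY, List.filter_cons]
  · intro hw
    by_cases hab : a.isLeft = b.isLeft
    · refine absurd ?_ hw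
      ext s t
      exact h1 a b s t hab
    · rcases a with a | a <;> rcases b with b | b <;> simp [degX, degY, List.filter_cons] at hab ⊢
  · refine fun hw => absurd ?_ hw
    ext s t
    have := h2 a b x s t
    simp only [gramCoeff, gramWord, Matrix.sub_apply, Matrix.of_apply, Option.elim_some,
      Option.elim_none] at this
    change p (FreeMonoid.ofList [a, b, x]) s t - ((Sᴴ * S) (.inl a, s) (.inr (b, x), t) +
      (Sᴴ * S) (.inr (b, a), s) (.inl x, t)) = 0
    linear_combination this
  · refine fun hw => absurd ?_ hw
    ext s t
    exact h3 (b, a) (x, y) s t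
  · refine fun hw => absurd ?_ hw
    rw [sub_zero]
    by_contra hne
    have := length_le_four_of_isXYConvex hconv _ hne
    simp only [FreeMonoid.toList_ofList, List.length_cons] at this
    omega

end Representation

/-- If a hermitian `d × d` matrix-valued free polynomial `p(x,y)` is
`xy`-convex, then `p = λ + Λ* Λ` for a hermitian `d × d` `xy`-pencil `λ` and an
`N × d` `xy`-pencil `Λ`. -/
theorem xyConvex_implies_pencil_representation {d μ : ℕ} (hd : 0 < d) (hμ : 0 < μ)
    (p : NCPoly d d μ) (hherm : polyStar p = p) (hconv : IsXYConvex p) :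
    ∃ lam : NCPoly d d μ, polyStar lam = lam ∧ IsXYPencil lam ∧
      ∃ N : ℕ, 0 < N ∧ ∃ Λ : NCPoly N d μ, IsXYPencil Λ ∧
        p = lam + polyMul (polyStar Λ) Λ := by
  obtain ⟨S, hS⟩ := exists_gramCoeff_sub_mem hherm hconv
  refine ⟨p - polyMul (polyStar (halfPoly S)) (halfPoly S), ?_, isXYPencil_sub_halfPoly hconv hS,
    Fintype.card (GramIndex d μ), ?_, halfPoly S, isXYPencil_halfPoly hconv hS,
    (sub_add_cancel _ _).symm⟩
  · have hQ := (polyStar_eq_self_iff _).1 (polyStar_polyMul_polyStar_halfPoly S)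
    rw [polyStar_eq_self_iff] at hherm ⊢
    intro w
    rw [Finsupp.sub_apply, Finsupp.sub_apply, Matrix.conjTranspose_sub, hherm, hQ]
  · exact Fintype.card_pos_iff.2 ⟨(.inl (.inl ⟨0, hμ⟩), ⟨0, hd⟩)⟩
end

section
/- If λ is a hermitian d×d matrix-valued xy-pencil and Λ is an N×d matrix-valued xy-pencil in the freely noncommuting variables x_1,…,x_μ, y_1,…,y_μ, then the hermitian polynomial p(x,y) = λ(x,y) + Λ(x,y)* Λ(x,y) is xy-convex. -/
open Matrix ComplexOrder

theorem wordEval_mul {μ : ℕ} {k : Type*} [Fintype k] [DecidableEq k]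
    (X Y : Fin μ → Matrix k k ℂ) (u v : FreeWord μ) :
    wordEval X Y (u * v) = wordEval X Y u * wordEval X Y v := by
  simp [wordEval]

theorem wordEval_reverse {μ : ℕ} {k : Type*} [Fintype k] [DecidableEq k]
    {X Y : Fin μ → Matrix k k ℂ} (hX : ∀ i, (X i).IsHermitian) (hY : ∀ i, (Y i).IsHermitian)
    (w : FreeWord μ) :
    wordEval X Y (FreeMonoid.ofList w.toList.reverse) = (wordEval X Y w)ᴴ := by
  have hletter : conjTranspose ∘ Sum.elim X Y = Sum.elim X Y := by
    funext s
    cases s with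
    | inl i => exact hX i
    | inr i => exact hY i
  simp [wordEval, conjTranspose_list_prod, hletter]

/-- Evaluation at a fixed pair of tuples, as an additive homomorphism. -/
noncomputable def polyEvalHom {μ : ℕ} {k : Type*} [Fintype k] [DecidableEq k] (N d : ℕ)
    (X Y : Fin μ → Matrix k k ℂ) : NCPoly N d μ →+ Matrix (Fin N × k) (Fin d × k) ℂ where
  toFun p := polyEval p X Y
  map_zero' := Finsupp.sum_zero_index
  map_add' _ _ := Finsupp.sum_add_index' (fun w => zero_kronecker (wordEval X Y w))
    fun w a b => add_kronecker a b (wordEval X Y w)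

theorem polyEval_add {N d μ : ℕ} {k : Type*} [Fintype k] [DecidableEq k] (p q : NCPoly N d μ)
    (X Y : Fin μ → Matrix k k ℂ) : polyEval (p + q) X Y = polyEval p X Y + polyEval q X Y :=
  map_add (polyEvalHom N d X Y) p q

theorem polyEval_single {N d μ : ℕ} {k : Type*} [Fintype k] [DecidableEq k] (w : FreeWord μ)
    (c : Matrix (Fin N) (Fin d) ℂ) (X Y : Fin μ → Matrix k k ℂ) :
    polyEval (Finsupp.single w c) X Y = kroneckerMap (· * ·) c (wordEval X Y w) :=
  Finsupp.sum_single_index (zero_kronecker (wordEval X Y w))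

theorem polyEval_polyMul {a b c μ : ℕ} {k : Type*} [Fintype k] [DecidableEq k]
    (p : NCPoly a b μ) (q : NCPoly b c μ) (X Y : Fin μ → Matrix k k ℂ) :
    polyEval (polyMul p q) X Y = polyEval p X Y * polyEval q X Y := by
  change polyEvalHom a c X Y (p.sum fun u cu => q.sum fun v cv => Finsupp.single (u * v) (cu * cv))
    = _
  simp only [map_finsuppSum]
  rw [polyEval, polyEval, Finsupp.sum, Finsupp.sum, Finsupp.sum, Matrix.sum_mul]
  refine Finset.sum_congr rfl fun u _ => ?_
  rw [Matrix.mul_sum]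
  refine Finset.sum_congr rfl fun v _ => ?_
  refine (polyEval_single _ _ X Y).trans ?_
  rw [wordEval_mul]
  exact mul_kronecker_mul _ _ _ _

theorem polyEval_polyStar {N d μ : ℕ} {k : Type*} [Fintype k] [DecidableEq k]
    {X Y : Fin μ → Matrix k k ℂ} (hX : ∀ i, (X i).IsHermitian) (hY : ∀ i, (Y i).IsHermitian)
    (p : NCPoly N d μ) : polyEval (polyStar p) X Y = (polyEval p X Y)ᴴ := by
  rw [polyEval, polyStar,
    Finsupp.sum_mapDomain_index (fun w => zero_kronecker (wordEval X Y w))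
      (fun w a b => add_kronecker a b (wordEval X Y w)),
    Finsupp.sum_mapRange_index (fun w => zero_kronecker (wordEval X Y _)),
    polyEval, Finsupp.sum, Finsupp.sum, conjTranspose_sum]
  refine Finset.sum_congr rfl fun w _ => ?_
  rw [wordEval_reverse hX hY]
  exact (conjTranspose_kronecker _ _).symm

theorem isHermitian_compress {μ : ℕ} {k l : Type*} [Fintype k] (V : Matrix k l ℂ)
    {X : Fin μ → Matrix k k ℂ} (hX : ∀ i, (X i).IsHermitian) (i : Fin μ) :
    (compress V X i).IsHermitian :=
  isHermitian_conjTranspose_mul_mul V (hX i)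

theorem wordEval_compress {μ : ℕ} {k l : Type*} [Fintype k] [DecidableEq k] [Fintype l]
    [DecidableEq l] {X Y : Fin μ → Matrix k k ℂ} (hX : ∀ i, (X i).IsHermitian)
    (hY : ∀ i, (Y i).IsHermitian) {V : Matrix k l ℂ} (hV : Vᴴ * V = 1)
    (hXY : ∀ i j, Vᴴ * (X i * Y j) * V = (Vᴴ * X i * V) * (Vᴴ * Y j * V))
    {w : FreeWord μ} (hwX : degX w ≤ 1) (hwY : degY w ≤ 1) :
    wordEval (compress V X) (compress V Y) w = Vᴴ * wordEval X Y w * V := by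
  have hYX : ∀ i j, Vᴴ * (Y j * X i) * V = (Vᴴ * Y j * V) * (Vᴴ * X i * V) := fun i j => by
    have h := congrArg conjTranspose (hXY i j)
    simpa only [conjTranspose_mul, conjTranspose_conjTranspose, (hX i).eq, (hY j).eq,
      Matrix.mul_assoc] using h
  unfold wordEval
  unfold degX at hwX
  unfold degY at hwY
  generalize w.toList = L at hwX hwY
  match L with
  | [] => simp [hV]
  | [.inl i] => simp [compress]
  | [.inr i] => simp [compress]
  | [.inl i, .inl j] => simp [List.filter_cons] at hwX
  | [.inr i, .inr j] => simp [List.filter_cons] at hwY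
  | [.inl i, .inr j] => simpa [compress] using (hXY i j).symm
  | [.inr j, .inl i] => simpa [compress] using (hYX i j).symm
  | a :: b :: c :: T => cases a <;> cases b <;> cases c <;> simp [List.filter_cons] at hwX hwY

theorem polyEval_compress {N d μ : ℕ} {k l : Type*} [Fintype k] [DecidableEq k] [Fintype l]
    [DecidableEq l] {X Y : Fin μ → Matrix k k ℂ} (hX : ∀ i, (X i).IsHermitian)
    (hY : ∀ i, (Y i).IsHermitian) {V : Matrix k l ℂ} (hV : Vᴴ * V = 1)
    (hXY : ∀ i j, Vᴴ * (X i * Y j) * V = (Vᴴ * X i * V) * (Vᴴ * Y j * V))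
    {Λ : NCPoly N d μ} (hΛ : IsXYPencil Λ) :
    polyEval Λ (compress V X) (compress V Y) =
      (kronId N V)ᴴ * polyEval Λ X Y * kronId d V := by
  rw [polyEval, polyEval, Finsupp.sum, Finsupp.sum, Matrix.mul_sum, Matrix.sum_mul]
  refine Finset.sum_congr rfl fun w hw => ?_
  obtain ⟨hwX, hwY⟩ := hΛ w (Finsupp.mem_support_iff.mp hw)
  have hkron : (kronId N V)ᴴ = kroneckerMap (· * ·) (1 : Matrix (Fin N) (Fin N) ℂ) Vᴴ :=
    (conjTranspose_kronecker _ _).trans (by rw [conjTranspose_one])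
  rw [wordEval_compress hX hY hV hXY hwX hwY, hkron, kronId, ← mul_kronecker_mul,
    ← mul_kronecker_mul, Matrix.one_mul, Matrix.mul_one]

theorem kronId_isometry {k l : Type*} [Fintype k] [DecidableEq l] (d : ℕ) {V : Matrix k l ℂ}
    (hV : Vᴴ * V = 1) : (kronId d V)ᴴ * kronId d V = 1 := by
  rw [kronId, conjTranspose_kronecker, ← mul_kronecker_mul, hV, conjTranspose_one, Matrix.one_mul,
    one_kronecker_one]

/-- The defect of a Gram matrix under compression of the factor by an isometry `W` is itself a
Gram matrix. -/
theorem posSemidef_gram_sub_gram_compression {r s t : Type*} [Fintype r] [DecidableEq r]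
    [Fintype s] [DecidableEq s] [Fintype t] (A : Matrix r t ℂ) {W : Matrix r s ℂ}
    (hW : Wᴴ * W = 1) : (Aᴴ * A - (Wᴴ * A)ᴴ * (Wᴴ * A)).PosSemidef := by
  have hgram : Aᴴ * A - (Wᴴ * A)ᴴ * (Wᴴ * A) =
      (A - W * (Wᴴ * A))ᴴ * (A - W * (Wᴴ * A)) := by
    have hproj : Wᴴ * (W * (Wᴴ * A)) = Wᴴ * A := by
      rw [← Matrix.mul_assoc, hW, Matrix.one_mul]
    simp only [conjTranspose_sub, conjTranspose_mul, conjTranspose_conjTranspose, Matrix.sub_mul,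
      Matrix.mul_sub, Matrix.mul_assoc, hproj]
    abel
  rw [hgram]
  exact posSemidef_conjTranspose_mul_self _

/-- If `λ` is a hermitian `d × d` matrix-valued `xy`-pencil and `Λ` is an
`N × d` matrix-valued `xy`-pencil, then the hermitian polynomial `p = λ + Λ* Λ` is
`xy`-convex. -/
theorem pencil_representation_implies_xyConvex {d μ N : ℕ} (hd : 0 < d) (hμ : 0 < μ)
    (hN : 0 < N) (lam : NCPoly d d μ) (hlherm : polyStar lam = lam) (hlam : IsXYPencil lam)
    (Λ : NCPoly N d μ) (hΛ : IsXYPencil Λ)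
    (p : NCPoly d d μ) (hp : p = lam + polyMul (polyStar Λ) Λ) :
    IsXYConvex p := by
  intro n m X Y hX hY V hV hXY
  subst hp
  have hgram := posSemidef_gram_sub_gram_compression (polyEval Λ X Y * kronId d V)
    (kronId_isometry N hV)
  rw [loewnerLE, polyEval_add, polyEval_add, polyEval_polyMul, polyEval_polyMul,
    polyEval_polyStar hX hY,
    polyEval_polyStar (isHermitian_compress V hX) (isHermitian_compress V hY),
    polyEval_compress hX hY hV hXY hlam, polyEval_compress hX hY hV hXY hΛ, Matrix.mul_add,
    Matrix.add_mul, add_sub_add_left_eq_sub]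
  simpa only [conjTranspose_mul, Matrix.mul_assoc] using hgram
end
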